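/- arXiv:0812.1616 — 8 statements merged into one kernel-verified Lean document; each statement's English description precedes it below -/
import Mathlib

section
/- For every n ≥ 1, the minimum rank of the path P_n on n vertices equals n − 1. -/
open Matrix

/-- `A` is a real symmetric matrix whose off-diagonal zero–nonzero pattern is described by the
simple graph `G`: for `i ≠ j`, `A i j ≠ 0` iff `{i,j}` is an edge of `G`. Diagonal entries are
unconstrained. -/
def DescribesGraph {V : Type*} [Fintype V] (G : SimpleGraph V) (A : Matrix V V ℝ) : Prop :=
  A.IsSymm ∧ ∀ i j : V, i ≠ j → (A i j ≠ 0 ↔ G.Adj i j)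

/-- The minimum rank `mr(G)` of a simple graph `G`: the smallest rank of a real symmetric matrix
described by `G`. -/
noncomputable def minrank {V : Type*} [Fintype V] (G : SimpleGraph V) : ℕ :=
  sInf {r : ℕ | ∃ A : Matrix V V ℝ, DescribesGraph G A ∧ A.rank = r}

open SimpleGraph

/-- A matrix described by a path on `m + 1` vertices has rank at least `m`: deleting the last row
and the first column leaves a lower triangular matrix with nonzero diagonal. -/
theorem DescribesGraph.le_rank_of_pathGraph {m : ℕ} {A : Matrix (Fin (m + 1)) (Fin (m + 1)) ℝ}
    (hA : DescribesGraph (pathGraph (m + 1)) A) : m ≤ A.rank := by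
  have htri : (A.submatrix Fin.castSucc Fin.succ).IsLowerTriangular := by
    intro i j hij
    have hij : i < j := hij
    have hne : i.castSucc ≠ j.succ := by
      simp only [ne_eq, Fin.ext_iff, Fin.val_castSucc, Fin.val_succ]
      lia
    by_contra h
    have := (hA.2 _ _ hne).1 h
    simp only [pathGraph_adj, Fin.val_castSucc, Fin.val_succ] at this
    lia
  have hdet : (A.submatrix Fin.castSucc Fin.succ).det ≠ 0 := by
    rw [Matrix.det_of_isLowerTriangular _ htri, Finset.prod_ne_zero_iff]
    intro i _
    exact (hA.2 _ _ i.castSucc_lt_succ.ne).2 (by simp [pathGraph_adj])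
  calc
    m = (A.submatrix Fin.castSucc Fin.succ).rank := by
      rw [Matrix.rank_of_det_ne_zero hdet, Fintype.card_fin]
    _ ≤ A.rank := Matrix.rank_submatrix_le _ _ _

theorem describesGraph_lapMatrix {V : Type*} [Fintype V] [DecidableEq V] (G : SimpleGraph V)
    [DecidableRel G.Adj] : DescribesGraph G (G.lapMatrix ℝ) := by
  refine ⟨G.isSymm_lapMatrix ℝ, fun i j hij => ?_⟩
  simp [lapMatrix, degMatrix, Matrix.diagonal_apply_ne _ hij, adjMatrix_apply]

theorem rank_lapMatrix_lt_card {V : Type*} [Fintype V] [DecidableEq V] [Nonempty V]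
    (G : SimpleGraph V) [DecidableRel G.Adj] : (G.lapMatrix ℝ).rank < Fintype.card V := by
  refine lt_of_le_of_ne (Matrix.rank_le_card_width _) fun h => ?_
  have hsurj : LinearMap.range (G.lapMatrix ℝ).mulVecLin = ⊤ :=
    Submodule.eq_top_of_finrank_eq (by rw [Module.finrank_pi]; exact h)
  have hunit : IsUnit (G.lapMatrix ℝ) :=
    Matrix.mulVec_surjective_iff_isUnit.1 (LinearMap.range_eq_top.1 hsurj)
  exact ((Matrix.isUnit_iff_isUnit_det _).1 hunit).ne_zero G.det_lapMatrix_eq_zero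

/-- For every `n ≥ 1`, the minimum rank of the path `P_n` on `n` vertices equals `n - 1`. -/
theorem minrank_pathGraph (n : ℕ) (hn : 1 ≤ n) :
    minrank (SimpleGraph.pathGraph n) = n - 1 := by
  classical
  obtain ⟨m, rfl⟩ := Nat.exists_eq_add_of_le' hn
  have hlap := describesGraph_lapMatrix (pathGraph (m + 1))
  refine le_antisymm ?_ (le_csInf ⟨_, _, hlap, rfl⟩ ?_)
  · have hle : minrank (pathGraph (m + 1)) ≤ ((pathGraph (m + 1)).lapMatrix ℝ).rank :=
      Nat.sInf_le ⟨_, hlap, rfl⟩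
    refine hle.trans (Nat.le_sub_one_of_lt ?_)
    simpa using rank_lapMatrix_lt_card (pathGraph (m + 1))
  · rintro _ ⟨A, hA, rfl⟩
    simpa using hA.le_rank_of_pathGraph
end

section
/- For every n ≥ 3, the minimum rank of the cycle C_n on n vertices equals n − 2. -/
open Matrix

/-- Adjacency in a cycle graph, for vertices listed in increasing order. -/
theorem cycleGraph_adj_iff_of_lt {n : ℕ} {i j : Fin n} (h : i < j) (hn : 3 ≤ n) :
    (SimpleGraph.cycleGraph n).Adj i j ↔
      (j : ℕ) = i + 1 ∨ (i : ℕ) = 0 ∧ (j : ℕ) = n - 1 := by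
  have h₁ := Fin.coe_sub_iff_lt.2 h
  have h₂ := Fin.coe_sub_iff_le.2 h.le
  rw [SimpleGraph.cycleGraph_adj', h₁, h₂]
  have := i.2
  have := j.2
  have : (i : ℕ) < j := h
  omega

theorem le_rank_of_describesGraph_cycleGraph {m : ℕ} (hm : 1 ≤ m)
    {A : Matrix (Fin (m + 2)) (Fin (m + 2)) ℝ}
    (hA : DescribesGraph (SimpleGraph.cycleGraph (m + 2)) A) : m ≤ A.rank := by
  let r : Fin m → Fin (m + 2) := fun i => ⟨i, by omega⟩
  let c : Fin m → Fin (m + 2) := fun i => ⟨i + 1, by omega⟩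
  have key (i j : Fin m) (hij : i ≤ j) : A (r i) (c j) ≠ 0 ↔ i = j := by
    have hlt : r i < c j := Nat.lt_succ_of_le hij
    rw [hA.2 _ _ hlt.ne, cycleGraph_adj_iff_of_lt hlt (by omega), Fin.ext_iff]
    simp only [r, c]
    omega
  have hdet : (A.submatrix r c).det ≠ 0 := by
    rw [Matrix.det_of_isLowerTriangular]
    · exact Finset.prod_ne_zero_iff.2 fun i _ => (key i i le_rfl).2 rfl
    · intro i j hij
      have hij' : i < j := hij
      exact not_not.1 fun h => hij'.ne ((key i j hij'.le).1 h)
  calc m = (A.submatrix r c).rank := by rw [Matrix.rank_of_det_ne_zero hdet, Fintype.card_fin]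
    _ ≤ A.rank := Matrix.rank_submatrix_le A r c

/-- The matrix whose `k`-th row is `e₀ + eₖ₊₁ - eₖ₊₂`. The rows correspond to the triangles of the
fan triangulation of the cycle. -/
def fanMatrix (m : ℕ) : Matrix (Fin m) (Fin (m + 2)) ℝ :=
  Matrix.of fun k j => (if (j : ℕ) = 0 then 1 else 0) + (if (k : ℕ) + 1 = j then 1 else 0)
    - (if (k : ℕ) + 2 = j then 1 else 0)

theorem fanMatrix_gram_zero {m : ℕ} {i j : Fin (m + 2)} (hi : (i : ℕ) = 0) (hj : 0 < (j : ℕ)) :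
    ((fanMatrix m)ᵀ * fanMatrix m) i j =
      (if (j : ℕ) ≤ m then 1 else 0) - (if 2 ≤ (j : ℕ) then 1 else 0) := by
  have hterm (k : Fin m) : fanMatrix m k i * fanMatrix m k j =
      (if (k : ℕ) = j - 1 then 1 else 0) -
        (if (k : ℕ) = j - 2 then (if 2 ≤ (j : ℕ) then 1 else 0) else 0) := by
    simp only [fanMatrix, Matrix.of_apply]
    grind
  have hj' := j.2
  simp only [Matrix.mul_apply, Matrix.transpose_apply, hterm, Finset.sum_sub_distrib]
  rw [Fin.sum_univ_eq_sum_range (fun k => if k = (j : ℕ) - 1 then (1 : ℝ) else 0),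
    Fin.sum_univ_eq_sum_range
      (fun k => if k = (j : ℕ) - 2 then (if 2 ≤ (j : ℕ) then (1 : ℝ) else 0) else 0)]
  simp only [Finset.sum_ite_eq', Finset.mem_range]
  grind

theorem fanMatrix_gram_pos {m : ℕ} {i j : Fin (m + 2)} (hi : 0 < (i : ℕ)) (hij : i < j) :
    ((fanMatrix m)ᵀ * fanMatrix m) i j = if (j : ℕ) = i + 1 then -1 else 0 := by
  have hij' : (i : ℕ) < j := hij
  have hj := j.2
  have hterm (k : Fin m) : fanMatrix m k i * fanMatrix m k j =
      if (k : ℕ) + 1 = i then (if (j : ℕ) = i + 1 then -1 else 0) else 0 := by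
    simp only [fanMatrix, Matrix.of_apply]
    grind
  simp only [Matrix.mul_apply, Matrix.transpose_apply, hterm]
  rw [Finset.sum_eq_single ⟨i - 1, by omega⟩]
  · simp [Nat.sub_add_cancel hi]
  · intro k _ hk
    refine if_neg fun h => hk (Fin.ext ?_)
    simp only
    omega
  · simp

theorem describesGraph_fanMatrix_gram {m : ℕ} (hm : 1 ≤ m) :
    DescribesGraph (SimpleGraph.cycleGraph (m + 2)) ((fanMatrix m)ᵀ * fanMatrix m) := by
  have hsymm : ((fanMatrix m)ᵀ * fanMatrix m).IsSymm := by
    simp [Matrix.IsSymm, Matrix.transpose_mul]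
  have key (i j : Fin (m + 2)) (hij : i < j) : ((fanMatrix m)ᵀ * fanMatrix m) i j ≠ 0 ↔
      (SimpleGraph.cycleGraph (m + 2)).Adj i j := by
    have hij' : (i : ℕ) < j := hij
    have hj := j.2
    rw [cycleGraph_adj_iff_of_lt hij (by omega)]
    rcases Nat.eq_zero_or_pos i with hi | hi
    · rw [fanMatrix_gram_zero hi (by omega)]
      grind
    · rw [fanMatrix_gram_pos hi hij]
      grind
  refine ⟨hsymm, fun i j hij => ?_⟩
  rcases hij.lt_or_gt with h | h
  · exact key i j h
  · rw [← hsymm.apply, SimpleGraph.adj_comm]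
    exact key j i h

/-- For every `n ≥ 3`, the minimum rank of the cycle `C_n` on `n` vertices equals `n - 2`. -/
theorem minrank_cycleGraph (n : ℕ) (hn : 3 ≤ n) :
    minrank (SimpleGraph.cycleGraph n) = n - 2 := by
  obtain ⟨m, rfl⟩ : ∃ m, n = m + 2 := ⟨n - 2, by omega⟩
  have hm : 1 ≤ m := by omega
  rw [Nat.add_sub_cancel]
  have hfan := describesGraph_fanMatrix_gram hm
  refine IsLeast.csInf_eq ⟨⟨_, hfan, le_antisymm ?_ ?_⟩, ?_⟩
  · exact (Matrix.rank_mul_le_right _ _).trans (Matrix.rank_le_height _)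
  · exact le_rank_of_describesGraph_cycleGraph hm hfan
  · rintro _ ⟨A, hA, rfl⟩
    exact le_rank_of_describesGraph_cycleGraph hm hA
end

section
/- For every simple graph G, the minimum rank of G is at most the edge clique cover number cc(G): if the edge set of G can be covered by k cliques of G, then mr(G) ≤ k. -/
open Matrix

open scoped Classical in
/-- The vertex-by-clique `0`/`1` incidence matrix of a family of vertex subsets. -/
noncomputable def cliqueIncMatrix {V : Type*} (C : Finset (Finset V)) : Matrix V C ℝ :=
  Matrix.of fun v c => if v ∈ c.1 then 1 else 0

/-- The Gram matrix of the incidence matrix of an edge clique cover of `G` is described by `G`. -/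
theorem describesGraph_cliqueIncMatrix_mul_transpose {V : Type*} [Fintype V] {G : SimpleGraph V}
    {C : Finset (Finset V)} (hclique : ∀ c ∈ C, G.IsClique (c : Set V))
    (hcover : ∀ u v : V, G.Adj u v → ∃ c ∈ C, u ∈ c ∧ v ∈ c) :
    DescribesGraph G (cliqueIncMatrix C * (cliqueIncMatrix C)ᵀ) := by
  classical
  refine ⟨by simp [Matrix.IsSymm, Matrix.transpose_mul], fun i j hij => ?_⟩
  have hnonneg : ∀ c ∈ (Finset.univ : Finset C),
      0 ≤ cliqueIncMatrix C i c * (cliqueIncMatrix C)ᵀ c j := by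
    intro c _
    simp only [cliqueIncMatrix, Matrix.transpose_apply, Matrix.of_apply]
    positivity
  rw [Matrix.mul_apply, ne_eq, Finset.sum_eq_zero_iff_of_nonneg hnonneg]
  constructor
  · intro h
    push Not at h
    obtain ⟨c, -, hc⟩ := h
    simp only [cliqueIncMatrix, Matrix.transpose_apply, Matrix.of_apply, ne_eq, mul_eq_zero,
      ite_eq_right_iff, one_ne_zero, imp_false, not_or, not_not] at hc
    exact hclique c c.2 hc.1 hc.2 hij
  · intro h h0
    obtain ⟨c, hc, hi, hj⟩ := hcover i j h
    simpa [cliqueIncMatrix, hi, hj] using h0 ⟨c, hc⟩ (Finset.mem_univ _)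

/-- If the edges of `G` can be covered by `k` cliques of `G`, then `mr(G) ≤ k`; in particular
`mr(G)` is at most the edge clique cover number `cc(G)`. -/
theorem minrank_le_cliqueCover (V : Type*) [Fintype V] (G : SimpleGraph V)
    (C : Finset (Finset V)) (hclique : ∀ c ∈ C, G.IsClique (c : Set V))
    (hcover : ∀ u v : V, G.Adj u v → ∃ c ∈ C, u ∈ c ∧ v ∈ c) :
    minrank G ≤ C.card := by
  calc minrank G ≤ (cliqueIncMatrix C * (cliqueIncMatrix C)ᵀ).rank :=
        Nat.sInf_le ⟨_, describesGraph_cliqueIncMatrix_mul_transpose hclique hcover, rfl⟩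
    _ ≤ (cliqueIncMatrix C).rank := Matrix.rank_mul_le_left _ _
    _ ≤ Fintype.card C := Matrix.rank_le_card_width _
    _ = C.card := Fintype.card_coe C
end

section
/- For every simple graph G on n vertices, the maximum nullity M(G) is at most the zero forcing number Z(G); equivalently, mr(G) ≥ n − Z(G). -/
open Matrix

/-- The set of vertices that eventually get colored black when starting from the set `S` of black
vertices and repeatedly applying the color change rule: a black vertex `u` whose neighbors other
than `w` are all black forces its (unique white) neighbor `w` to become black. -/
inductive ZFClosed {V : Type*} (G : SimpleGraph V) (S : Set V) : V → Prop
  | init (v : V) (hv : v ∈ S) : ZFClosed G S v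
  | force (u w : V) (hu : ZFClosed G S u) (hadj : G.Adj u w)
      (h : ∀ x, G.Adj u x → x ≠ w → ZFClosed G S x) : ZFClosed G S w

/-- `S` is a zero forcing set of `G` if iterating the color change rule starting from `S` colors
every vertex black. -/
def IsZeroForcingSet {V : Type*} (G : SimpleGraph V) (S : Set V) : Prop :=
  ∀ v, ZFClosed G S v

/-- The zero forcing number `Z(G)`: the minimum cardinality of a zero forcing set of `G`. -/
noncomputable def zeroForcingNumber {V : Type*} [Fintype V] (G : SimpleGraph V) : ℕ :=
  sInf {k : ℕ | ∃ S : Finset V, S.card = k ∧ IsZeroForcingSet G ↑S}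

/-- A kernel vector of a matrix described by `G` which vanishes on `S` vanishes on every vertex
that is eventually colored black starting from `S`. -/
theorem ZFClosed.apply_eq_zero {V : Type*} [Fintype V] {G : SimpleGraph V} {S : Set V}
    {A : Matrix V V ℝ} (hA : DescribesGraph G A) {x : V → ℝ} (hx : A *ᵥ x = 0)
    (hS : ∀ v ∈ S, x v = 0) {v : V} (hv : ZFClosed G S v) : x v = 0 := by
  induction hv with
  | init v hv => exact hS v hv
  | force u w _ hadj _ hu h =>
    have hrow : ∑ j, A u j * x j = 0 := congrFun hx u
    rw [Finset.sum_eq_single w] at hrow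
    · exact (mul_eq_zero.mp hrow).resolve_left ((hA.2 u w hadj.ne).mpr hadj)
    · intro j _ hjw
      by_cases huj : u = j
      · rw [← huj, hu, mul_zero]
      by_cases hj : G.Adj u j
      · rw [h j hj hjw, mul_zero]
      · rw [not_not.mp (mt (hA.2 u j huj).mp hj), zero_mul]
    · exact fun hw => absurd (Finset.mem_univ w) hw

/-- The order of `G` is at most the rank of a matrix described by `G` plus the size of a zero
forcing set. -/
theorem IsZeroForcingSet.card_le_rank_add_card {V : Type*} [Fintype V] {G : SimpleGraph V}
    {S : Finset V} (hS : IsZeroForcingSet G (S : Set V)) {A : Matrix V V ℝ}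
    (hA : DescribesGraph G A) : Fintype.card V ≤ A.rank + S.card := by
  have hinj : Function.Injective
      ((LinearMap.funLeft ℝ ℝ ((↑) : S → V)).comp (LinearMap.ker A.mulVecLin).subtype) := by
    rw [injective_iff_map_eq_zero]
    rintro ⟨x, hx⟩ h
    ext v
    exact ZFClosed.apply_eq_zero hA (by simpa using hx) (fun w hw => congrFun h ⟨w, hw⟩) (hS v)
  have hker := LinearMap.finrank_le_finrank_of_injective hinj
  have hrank := A.mulVecLin.finrank_range_add_finrank_ker
  rw [Module.finrank_fintype_fun_eq_card] at hker hrank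
  rw [Fintype.card_coe] at hker
  unfold Matrix.rank
  omega

/-- Every graph describes some matrix, namely its adjacency matrix. -/
theorem exists_describesGraph {V : Type*} [Fintype V] (G : SimpleGraph V) :
    ∃ A : Matrix V V ℝ, DescribesGraph G A := by
  classical
  exact ⟨G.adjMatrix ℝ, G.isSymm_adjMatrix, fun i j _ => by simp [SimpleGraph.adjMatrix_apply]⟩

/-- For every simple graph `G` on `n` vertices, the maximum nullity `M(G) = n - mr(G)` is at most
the zero forcing number `Z(G)`; equivalently `mr(G) ≥ n - Z(G)`. -/
theorem maxNullity_le_zeroForcingNumber (V : Type*) [Fintype V] (G : SimpleGraph V) :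
    Fintype.card V - minrank G ≤ zeroForcingNumber G ∧
      Fintype.card V - zeroForcingNumber G ≤ minrank G := by
  obtain ⟨A, hA, hrank⟩ :
      minrank G ∈ {r : ℕ | ∃ A : Matrix V V ℝ, DescribesGraph G A ∧ A.rank = r} :=
    Nat.sInf_mem ((exists_describesGraph G).elim fun A hA => ⟨_, A, hA, rfl⟩)
  obtain ⟨S, hcard, hS⟩ :
      zeroForcingNumber G ∈ {k : ℕ | ∃ S : Finset V, S.card = k ∧ IsZeroForcingSet G ↑S} :=
    Nat.sInf_mem ⟨_, Finset.univ, rfl, fun v => .init v (by simp)⟩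
  have := hS.card_le_rank_add_card hA
  omega
end

section
/- Let v be a cut vertex of a connected simple graph G, let W_1, …, W_h be the vertex sets of the connected components of G − v, and let G_i be the subgraph of G induced by W_i ∪ {v}. Then mr(G) = min{ Σ_{i=1}^h mr(G_i), Σ_{i=1}^h mr(G_i − v) + 2 }. -/
open Matrix

namespace Matrix

variable {K : Type*} [Field K]

theorem rank_add_le_rank_add_rank {m n : Type*} [Fintype m] [Fintype n] (A B : Matrix m n K) :
    (A + B).rank ≤ A.rank + B.rank := by
  rw [Matrix.rank, mulVecLin_add]
  exact (Submodule.finrank_mono (LinearMap.range_add_le _ _)).trans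
    (Submodule.finrank_add_le_finrank_add_finrank _ _)

theorem rank_sum_le_sum_rank {ι m n : Type*} [Fintype m] [Fintype n] (s : Finset ι)
    (A : ι → Matrix m n K) : (∑ i ∈ s, A i).rank ≤ ∑ i ∈ s, (A i).rank :=
  Finset.le_sum_of_subadditive _ rank_zero.le rank_add_le_rank_add_rank _ _

theorem blockDiagonal'_mulVec_apply {ι : Type*} [Fintype ι] [DecidableEq ι] {m n : ι → Type*}
    [∀ i, Fintype (n i)] (M : ∀ i, Matrix (m i) (n i) K) (x : (Σ i, n i) → K) (i : ι) (a : m i) :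
    (blockDiagonal' M *ᵥ x) ⟨i, a⟩ = (M i *ᵥ fun b => x ⟨i, b⟩) a := by
  simp only [mulVec, dotProduct, Fintype.sum_sigma]
  rw [Finset.sum_eq_single i (fun j _ hj => Finset.sum_eq_zero fun b _ => by
    rw [blockDiagonal'_apply_ne M a b hj.symm, zero_mul]) (by simp)]
  simp

theorem sum_rank_le_rank_blockDiagonal' {ι : Type*} [Fintype ι] [DecidableEq ι] {m n : ι → Type*}
    [∀ i, Fintype (m i)] [∀ i, Fintype (n i)] (M : ∀ i, Matrix (m i) (n i) K) :
    ∑ i, (M i).rank ≤ (blockDiagonal' M).rank := by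
  let φ : (∀ i, LinearMap.range (M i).mulVecLin) →ₗ[K] ((Σ i, m i) → K) :=
    { toFun := fun y p => (y p.1 : m p.1 → K) p.2
      map_add' := fun _ _ => rfl
      map_smul' := fun _ _ => rfl }
  have hφ : ∀ y, φ y ∈ LinearMap.range (blockDiagonal' M).mulVecLin := by
    intro y
    choose x hx using fun i => (y i).2
    refine ⟨fun p => x p.1 p.2, funext fun ⟨i, a⟩ => ?_⟩
    rw [mulVecLin_apply, blockDiagonal'_mulVec_apply]
    exact congrFun (hx i) a
  have hinj : Function.Injective (φ.codRestrict _ hφ) := fun y z hyz => by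
    funext i
    ext a
    exact congrFun (congrArg Subtype.val hyz) ⟨i, a⟩
  simpa [Matrix.rank, Module.finrank_pi_fintype] using
    LinearMap.finrank_le_finrank_of_injective hinj

theorem rank_add_one_le_rank_fromCols {m n : Type*} [Fintype m] [Fintype n] {C : Matrix m n K}
    {c : m → K} (hc : c ∉ LinearMap.range C.mulVecLin) :
    C.rank + 1 ≤ (fromCols C (replicateCol Unit c)).rank := by
  rw [Matrix.rank, ← Submodule.finrank_sup_span_singleton hc]
  refine Submodule.finrank_mono (sup_le ?_ ?_)
  · rintro _ ⟨x, rfl⟩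
    exact ⟨Sum.elim x 0, by simp [fromCols_mulVec]⟩
  · rw [Submodule.span_singleton_le_iff_mem]
    refine ⟨Sum.elim 0 1, ?_⟩
    ext
    simp [mulVec, dotProduct]

/-- Bordering a symmetric matrix by a vector outside its column space raises the rank by two. -/
theorem rank_add_two_le_rank_fromBlocks {n : Type*} [Fintype n] {B : Matrix n n K} (hB : B.IsSymm)
    {b : n → K} (hb : b ∉ LinearMap.range B.mulVecLin) (a : K) :
    B.rank + 2 ≤
      (fromBlocks B (replicateCol Unit b) (replicateRow Unit b) (of fun _ _ => a)).rank := by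
  have h₁ : B.rank + 1 ≤ (fromRows B (replicateRow Unit b)).rank := by
    rw [← rank_transpose (fromRows B _), transpose_fromRows, hB.eq, transpose_replicateRow]
    exact rank_add_one_le_rank_fromCols hb
  have h₂ : Sum.elim b (fun _ => a) ∉
      LinearMap.range (fromRows B (replicateRow Unit b)).mulVecLin := by
    rintro ⟨x, hx⟩
    refine hb ⟨x, funext fun i => ?_⟩
    simpa [fromRows_mulVec] using congrFun hx (Sum.inl i)
  have h₃ : fromBlocks B (replicateCol Unit b) (replicateRow Unit b) (of fun _ _ => a) =
      fromCols (fromRows B (replicateRow Unit b))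
        (replicateCol Unit (Sum.elim b (fun _ => a))) := by
    ext (i | i) (j | j) <;> rfl
  have h₄ := rank_add_one_le_rank_fromCols h₂
  rw [h₃]
  omega

/-- The extension by zero of a matrix indexed by a subset. -/
noncomputable def extendZero {V : Type*} (S : Set V) (M : Matrix S S K) : Matrix V V K :=
  open Classical in
  of fun u w => if h : u ∈ S ∧ w ∈ S then M ⟨u, h.1⟩ ⟨w, h.2⟩ else 0

theorem extendZero_of_mem {V : Type*} {S : Set V} (M : Matrix S S K) {u w : V} (hu : u ∈ S)
    (hw : w ∈ S) : extendZero S M u w = M ⟨u, hu⟩ ⟨w, hw⟩ := by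
  simp [extendZero, hu, hw]

theorem extendZero_of_not_mem {V : Type*} {S : Set V} (M : Matrix S S K) {u w : V}
    (h : ¬(u ∈ S ∧ w ∈ S)) : extendZero S M u w = 0 := by
  simp only [extendZero, of_apply, dif_neg h]

theorem IsSymm.extendZero {V : Type*} {S : Set V} {M : Matrix S S K} (hM : M.IsSymm) :
    (extendZero S M).IsSymm := by
  ext u w
  by_cases h : u ∈ S ∧ w ∈ S
  · rw [transpose_apply, extendZero_of_mem M h.2 h.1, extendZero_of_mem M h.1 h.2, hM.apply]
  · rw [transpose_apply, extendZero_of_not_mem M (fun h' => h h'.symm), extendZero_of_not_mem M h]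

theorem rank_extendZero_le {V : Type*} [Fintype V] (S : Set V) [Fintype S] (M : Matrix S S K) :
    (extendZero S M).rank ≤ M.rank := by
  classical
  let E : Matrix V S K := of fun u s => if u = s then 1 else 0
  have hE : Matrix.extendZero S M = E * M * Eᵀ := by
    ext u w
    by_cases hu : u ∈ S
    · by_cases hw : w ∈ S
      · rw [extendZero_of_mem M hu hw, mul_apply, Finset.sum_eq_single ⟨w, hw⟩, mul_apply,
          Finset.sum_eq_single ⟨u, hu⟩]
        · simp [E]
        · rintro ⟨s, hs⟩ - hne
          have : u ≠ s := by rintro rfl; exact hne rfl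
          simp [E, this]
        · simp
        · rintro ⟨s, hs⟩ - hne
          have : w ≠ s := by rintro rfl; exact hne rfl
          simp [E, this]
        · simp
      · rw [extendZero_of_not_mem M (fun h => hw h.2), mul_apply, Finset.sum_eq_zero]
        rintro ⟨s, hs⟩ -
        have : w ≠ s := by rintro rfl; exact hw hs
        simp [E, this]
    · rw [extendZero_of_not_mem M (fun h => hu h.1), Matrix.mul_assoc, mul_apply,
        Finset.sum_eq_zero]
      rintro ⟨s, hs⟩ -
      have : u ≠ s := by rintro rfl; exact hu hs
      simp [E, this]
  rw [hE]
  exact (rank_mul_le_left _ _).trans (rank_mul_le_right _ _)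

end Matrix

theorem minrank_le_rank {V : Type*} [Fintype V] {G : SimpleGraph V} {A : Matrix V V ℝ}
    (hA : DescribesGraph G A) : minrank G ≤ A.rank :=
  Nat.sInf_le ⟨A, hA, rfl⟩

theorem exists_rank_eq_minrank {V : Type*} [Fintype V] (G : SimpleGraph V) :
    ∃ A : Matrix V V ℝ, DescribesGraph G A ∧ A.rank = minrank G := by
  classical
  refine Nat.sInf_mem (s := {r : ℕ | ∃ A : Matrix V V ℝ, DescribesGraph G A ∧ A.rank = r})
    ⟨_, G.adjMatrix ℝ, ⟨G.isSymm_adjMatrix, fun i j _ => ?_⟩, rfl⟩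
  simp [SimpleGraph.adjMatrix_apply]

namespace DescribesGraph

variable {V : Type*} {G : SimpleGraph V}

theorem submatrix [Fintype V] {A : Matrix V V ℝ} (hA : DescribesGraph G A) (S : Set V)
    [Fintype S] :
    DescribesGraph (G.induce S) (A.submatrix Subtype.val Subtype.val) :=
  ⟨hA.1.submatrix _, fun i j hij => hA.2 i j fun h => hij (Subtype.ext h)⟩

theorem extendZero_ne_zero_iff {S : Set V} [Fintype S] {M : Matrix S S ℝ}
    (hM : DescribesGraph (G.induce S) M) {u w : V} (huw : u ≠ w) (hu : u ∈ S) (hw : w ∈ S) :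
    extendZero S M u w ≠ 0 ↔ G.Adj u w := by
  rw [extendZero_of_mem M hu hw]
  exact hM.2 ⟨u, hu⟩ ⟨w, hw⟩ fun h => huw (congrArg Subtype.val h)

/-- Off the diagonal, if at most one of the sets `S i` contains both `u` and `w`, and one of them
does when `u` and `w` are adjacent, then the sum of the zero extensions has the pattern of `G`. -/
theorem sum_extendZero_ne_zero_iff {ι : Type*} [Fintype ι] {S : ι → Set V}
    [∀ i, Fintype (S i)] {M : ∀ i, Matrix (S i) (S i) ℝ}
    (hM : ∀ i, DescribesGraph (G.induce (S i)) (M i)) {u w : V} (huw : u ≠ w)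
    (hunique : ∀ i j, u ∈ S i → w ∈ S i → u ∈ S j → w ∈ S j → i = j)
    (hadj : G.Adj u w → ∃ i, u ∈ S i ∧ w ∈ S i) :
    (∑ i, extendZero (S i) (M i)) u w ≠ 0 ↔ G.Adj u w := by
  rw [Matrix.sum_apply]
  by_cases hex : ∃ i, u ∈ S i ∧ w ∈ S i
  · obtain ⟨i, hu, hw⟩ := hex
    rw [Finset.sum_eq_single i (fun j _ hj => extendZero_of_not_mem _ fun h =>
      hj (hunique j i h.1 h.2 hu hw)) (by simp)]
    exact (hM i).extendZero_ne_zero_iff huw hu hw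
  · rw [Finset.sum_eq_zero fun i _ => extendZero_of_not_mem _ fun h => hex ⟨i, h⟩]
    simpa using fun h => hex (hadj h)

end DescribesGraph

theorem minrank_le_sum_minrank_induce {V ι : Type*} [Fintype V] [Fintype ι] (G : SimpleGraph V)
    (S : ι → Set V) [∀ i, Fintype (S i)]
    (hunique : ∀ u w, u ≠ w → ∀ i j, u ∈ S i → w ∈ S i → u ∈ S j → w ∈ S j → i = j)
    (hadj : ∀ u w, G.Adj u w → ∃ i, u ∈ S i ∧ w ∈ S i) :
    minrank G ≤ ∑ i, minrank (G.induce (S i)) := by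
  choose M hM hr using fun i => exists_rank_eq_minrank (G.induce (S i))
  have hsymm : (∑ i, extendZero (S i) (M i)).IsSymm := by
    rw [IsSymm, transpose_sum]
    exact Finset.sum_congr rfl fun i _ => (hM i).1.extendZero
  refine (minrank_le_rank ⟨hsymm, fun u w huw =>
    DescribesGraph.sum_extendZero_ne_zero_iff hM huw (hunique u w huw) (hadj u w)⟩).trans ?_
  refine (rank_sum_le_sum_rank _ _).trans (Finset.sum_le_sum fun i _ => ?_)
  exact (rank_extendZero_le _ _).trans (hr i).le

theorem minrank_le_sum_minrank_induce_add_two {V ι : Type*} [Fintype V] [Fintype ι]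
    (G : SimpleGraph V) (v : V) (S : ι → Set V) [∀ i, Fintype (S i)] (hv : ∀ i, v ∉ S i)
    (hunique : ∀ u i j, u ∈ S i → u ∈ S j → i = j)
    (hadj : ∀ u w, u ≠ v → w ≠ v → G.Adj u w → ∃ i, u ∈ S i ∧ w ∈ S i) :
    minrank G ≤ (∑ i, minrank (G.induce (S i))) + 2 := by
  classical
  choose M hM hr using fun i => exists_rank_eq_minrank (G.induce (S i))
  let B := ∑ i, extendZero (S i) (M i)
  let e : V → ℝ := Pi.single v 1
  let r : V → ℝ := fun w => if G.Adj v w then 1 else 0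
  have hBv : ∀ u w, u = v ∨ w = v → B u w = 0 := by
    intro u w h
    simp only [B, Matrix.sum_apply]
    refine Finset.sum_eq_zero fun i _ => extendZero_of_not_mem _ ?_
    rintro ⟨hu, hw⟩
    rcases h with rfl | rfl
    · exact hv i hu
    · exact hv i hw
  have hsymm : (B + (vecMulVec e r + vecMulVec r e)).IsSymm := by
    refine IsSymm.add ?_ ?_
    · rw [IsSymm, transpose_sum]
      exact Finset.sum_congr rfl fun i _ => (hM i).1.extendZero
    · rw [IsSymm, transpose_add, transpose_vecMulVec, transpose_vecMulVec, add_comm]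
  have hA : DescribesGraph G (B + (vecMulVec e r + vecMulVec r e)) := by
    refine ⟨hsymm, fun u w huw => ?_⟩
    simp only [Matrix.add_apply, vecMulVec_apply]
    by_cases hu : u = v
    · subst hu
      rw [hBv u w (Or.inl rfl)]
      simp [e, r, huw.symm]
    · by_cases hw : w = v
      · subst hw
        rw [hBv u w (Or.inr rfl)]
        simp [e, r, huw, G.adj_comm]
      · have : e u * r w + r u * e w = 0 := by simp [e, hu, hw]
        rw [this, add_zero]
        exact DescribesGraph.sum_extendZero_ne_zero_iff hM huw
          (fun i j hi _ hj _ => hunique u i j hi hj) (hadj u w hu hw)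
  have hB : B.rank ≤ ∑ i, minrank (G.induce (S i)) :=
    (rank_sum_le_sum_rank _ _).trans (Finset.sum_le_sum fun i _ =>
      (rank_extendZero_le _ _).trans (hr i).le)
  have h₁ := minrank_le_rank hA
  have h₂ := rank_add_le_rank_add_rank B (vecMulVec e r + vecMulVec r e)
  have h₃ := rank_add_le_rank_add_rank (vecMulVec e r) (vecMulVec r e)
  have h₄ := rank_vecMulVec_le e r
  have h₅ := rank_vecMulVec_le r e
  omega

/-- If the `v`-column of `A` restricted to `W` lies in the column space of `A[W]`, then the corner
entry can be adjusted so that the bordered matrix has the rank of `A[W]`. -/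
theorem minrank_induce_insert_le {V : Type*} [Fintype V] [DecidableEq V] {G : SimpleGraph V}
    {A : Matrix V V ℝ} (hA : DescribesGraph G A) {v : V} {W : Finset V}
    {B : Matrix (W : Set V) (W : Set V) ℝ} (hBA : B = A.submatrix Subtype.val Subtype.val)
    (hb : (fun w : ↥(W : Set V) => A w v) ∈ LinearMap.range B.mulVecLin) :
    minrank (G.induce ((insert v W : Finset V) : Set V)) ≤ B.rank := by
  obtain ⟨x, hx⟩ := hb
  have hB : B.IsSymm := hBA ▸ hA.1.submatrix _
  let E : Matrix ((insert v W : Finset V) : Set V) (W : Set V) ℝ :=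
    of fun u => if h : (u : V) ∈ W then Pi.single ⟨u, h⟩ 1 else x
  have hEmem : ∀ (u : ((insert v W : Finset V) : Set V)) (h : (u : V) ∈ W),
      E u = Pi.single ⟨u, h⟩ 1 := fun u h => dif_pos h
  have hEnot : ∀ u : ((insert v W : Finset V) : Set V), (u : V) ∉ W → E u = x :=
    fun u h => dif_neg h
  have hentry : ∀ u w, (E * B * Eᵀ) u w = E u ⬝ᵥ (B *ᵥ E w) := by
    intro u w
    rw [Matrix.mul_assoc, mul_apply]
    rfl
  have hsymm : (E * B * Eᵀ).IsSymm := by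
    simp [IsSymm, transpose_mul, hB.eq, Matrix.mul_assoc]
  have key : ∀ u w : ((insert v W : Finset V) : Set V), u ≠ w → (u : V) ∈ W →
      (E * B * Eᵀ) u w = A u w := by
    intro u w huw hu
    rw [hentry, hEmem u hu, single_one_dotProduct]
    by_cases hw : (w : V) ∈ W
    · rw [hEmem w hw, mulVec_single_one, hBA]
      rfl
    · have hwv : (w : V) = v := (Finset.mem_insert.1 w.2).resolve_right hw
      rw [hEnot w hw, ← mulVecLin_apply, hx, hwv]
  refine (minrank_le_rank (A := E * B * Eᵀ) ⟨hsymm, fun u w huw => ?_⟩).trans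
    ((rank_mul_le_left _ _).trans (rank_mul_le_right _ _))
  have hval : (u : V) ≠ w := fun h => huw (Subtype.ext h)
  by_cases hu : (u : V) ∈ W
  · rw [key u w huw hu]
    exact hA.2 u w hval
  · have huv : (u : V) = v := (Finset.mem_insert.1 u.2).resolve_right hu
    have hw : (w : V) ∈ W := (Finset.mem_insert.1 w.2).resolve_left
      fun h => hval (huv.trans h.symm)
    rw [← hsymm.apply, key w u huw.symm hw, hA.1.apply]
    exact hA.2 u w hval

/-- Cut vertex reduction: if `v` is a cut vertex of the connected graph `G` and
`W 1, …, W h` (with `h ≥ 2`) are the vertex sets of the connected components of `G - v`, and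
`Gᵢ` is the subgraph induced by `W i ∪ {v}`, then
`mr(G) = min (∑ mr(Gᵢ)) (∑ mr(Gᵢ - v) + 2)`. -/
theorem minrank_cutVertex (V : Type*) [Fintype V] [DecidableEq V] (G : SimpleGraph V)
    (hG : G.Connected) (v : V) (h : ℕ) (hh : 2 ≤ h) (W : Fin h → Finset V)
    (hv : ∀ i, v ∉ W i)
    (hdisj : ∀ i j, i ≠ j → Disjoint (W i) (W j))
    (hcover : ∀ u : V, u ≠ v → ∃ i, u ∈ W i)
    (hconn : ∀ i, (G.induce ((W i : Set V))).Connected)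
    (hnoedge : ∀ i j, i ≠ j → ∀ u ∈ W i, ∀ w ∈ W j, ¬ G.Adj u w) :
    minrank G =
      min (∑ i, minrank (G.induce ((insert v (W i) : Finset V) : Set V)))
        ((∑ i, minrank (G.induce ((W i : Set V)))) + 2) := by
  have hinter : ∀ u i j, u ∈ W i → u ∈ W j → i = j := fun u i j hi hj => by
    by_contra hne
    exact Finset.disjoint_left.1 (hdisj i j hne) hi hj
  have hadj : ∀ u w, u ≠ v → w ≠ v → G.Adj u w → ∃ i, u ∈ W i ∧ w ∈ W i := by
    intro u w hu hw huw
    obtain ⟨i, hi⟩ := hcover u hu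
    obtain ⟨j, hj⟩ := hcover w hw
    obtain rfl : i = j := by
      by_contra hne
      exact hnoedge i j hne u hi w hj huw
    exact ⟨i, hi, hj⟩
  refine le_antisymm (le_min ?_ ?_) ?_
  · refine minrank_le_sum_minrank_induce G
      (fun i => ((insert v (W i) : Finset V) : Set V)) ?_ ?_
    · intro u w huw i j hui hwi huj hwj
      simp only [Finset.mem_coe, Finset.mem_insert] at hui hwi huj hwj
      by_cases hu : u = v
      · have hw : w ≠ v := fun h => huw (hu.trans h.symm)
        exact hinter w i j (hwi.resolve_left hw) (hwj.resolve_left hw)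
      · exact hinter u i j (hui.resolve_left hu) (huj.resolve_left hu)
    · intro u w huw
      simp only [Finset.mem_coe, Finset.mem_insert]
      by_cases hu : u = v
      · obtain ⟨i, hi⟩ := hcover w (hu ▸ huw.ne')
        exact ⟨i, Or.inl hu, Or.inr hi⟩
      · by_cases hw : w = v
        · obtain ⟨i, hi⟩ := hcover u hu
          exact ⟨i, Or.inr hi, Or.inl hw⟩
        · obtain ⟨i, hi, hj⟩ := hadj u w hu hw huw
          exact ⟨i, Or.inr hi, Or.inr hj⟩
  · exact minrank_le_sum_minrank_induce_add_two G v (fun i => (W i : Set V)) hv hinter hadj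
  obtain ⟨A, hA, hr⟩ := exists_rank_eq_minrank G
  rw [← hr]
  let B : ∀ i, Matrix (W i : Set V) (W i : Set V) ℝ := fun i =>
    A.submatrix Subtype.val Subtype.val
  let f : (Σ i, (W i : Set V)) → V := fun p => p.2
  have hblock : A.submatrix f f = blockDiagonal' B := by
    ext ⟨i, u, hu⟩ ⟨j, w, hw⟩
    by_cases hij : i = j
    · subst hij
      rw [blockDiagonal'_apply_eq]
      rfl
    · rw [blockDiagonal'_apply_ne _ _ _ hij]
      by_contra hne
      have huw : u ≠ w := by
        rintro rfl
        exact hij (hinter u i j hu hw)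
      exact hnoedge i j hij u hu w hw ((hA.2 u w huw).1 hne)
  by_cases hb : ∀ i, (fun w : (W i : Set V) => A w v) ∈ LinearMap.range (B i).mulVecLin
  · refine (min_le_left _ _).trans ?_
    calc _ ≤ ∑ i, (B i).rank :=
          Finset.sum_le_sum fun i _ => minrank_induce_insert_le hA rfl (hb i)
      _ ≤ (blockDiagonal' B).rank := sum_rank_le_rank_blockDiagonal' B
      _ ≤ A.rank := hblock ▸ rank_submatrix_le A f f
  · refine (min_le_right _ _).trans ?_
    obtain ⟨i, hi⟩ := not_forall.1 hb
    have hbB : (fun p => A (f p) v) ∉ LinearMap.range (blockDiagonal' B).mulVecLin := by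
      rintro ⟨x, hx⟩
      refine hi ⟨fun w => x ⟨i, w⟩, funext fun w => ?_⟩
      rw [mulVecLin_apply, ← blockDiagonal'_mulVec_apply]
      exact congrFun hx ⟨i, w⟩
    have hM : A.submatrix (Sum.elim f fun _ : Unit => v) (Sum.elim f fun _ : Unit => v) =
        fromBlocks (blockDiagonal' B) (replicateCol Unit fun p => A (f p) v)
          (replicateRow Unit fun p => A (f p) v) (of fun _ _ => A v v) := by
      rw [← hblock]
      ext (p | p) (q | q)
      · rfl
      · rfl
      · exact hA.1.apply _ _
      · rfl
    calc _ ≤ (∑ i, (B i).rank) + 2 :=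
          Nat.add_le_add_right
            (Finset.sum_le_sum fun i _ => minrank_le_rank (hA.submatrix _)) 2
      _ ≤ (blockDiagonal' B).rank + 2 :=
          Nat.add_le_add_right (sum_rank_le_rank_blockDiagonal' B) 2
      _ ≤ _ := rank_add_two_le_rank_fromBlocks (hblock ▸ hA.1.submatrix f) hbB (A v v)
      _ ≤ A.rank := hM ▸ rank_submatrix_le A _ _
end

section
/- For every tree T on n vertices, the zero forcing number of T equals its path cover number: Z(T) = P(T). -/
/-- A path cover of `G`: a collection of pairwise disjoint vertex subsets, each inducing a
(nonempty) path in `G`, whose union is all of `V`. -/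
def IsPathCover {V : Type*} [Fintype V] (G : SimpleGraph V) (PC : Finset (Finset V)) : Prop :=
  (∀ P ∈ PC, ∃ k : ℕ, 0 < k ∧ Nonempty ((G.induce (P : Set V)) ≃g SimpleGraph.pathGraph k)) ∧
  (∀ P ∈ PC, ∀ Q ∈ PC, P ≠ Q → Disjoint P Q) ∧
  (∀ v : V, ∃ P ∈ PC, v ∈ P)

/-- The path cover number `P(G)`: the minimum number of paths in a path cover of `G`. -/
noncomputable def pathCoverNumber {V : Type*} [Fintype V] (G : SimpleGraph V) : ℕ :=
  sInf {k : ℕ | ∃ PC : Finset (Finset V), PC.card = k ∧ IsPathCover G PC}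
namespace SimpleGraph

variable {V ι : Type*} {G : SimpleGraph V}

/-- `G.PathLabeling B c h` says that, for each label `a`, the vertices of `B` labelled `a` by `c`
induce a path in `G`, along which the height `h` takes the values `0, 1, 2, …` in order. -/
structure PathLabeling (G : SimpleGraph V) (B : Set V) (c : V → ι) (h : V → ℕ) : Prop where
  inj : ∀ u ∈ B, ∀ v ∈ B, c u = c v → h u = h v → u = v
  pred : ∀ v ∈ B, h v ≠ 0 → ∃ u ∈ B, c u = c v ∧ h u + 1 = h v
  adj_iff : ∀ u ∈ B, ∀ v ∈ B, c u = c v → (G.Adj u v ↔ h u + 1 = h v ∨ h v + 1 = h u)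

lemma PathLabeling.exists_height {B : Set V} {c : V → ι} {h : V → ℕ}
    (hl : G.PathLabeling B c h) {v : V} (hv : v ∈ B) {i : ℕ} (hi : i ≤ h v) :
    ∃ u ∈ B, c u = c v ∧ h u = i := by
  induction hi using Nat.decreasingInduction with
  | self => exact ⟨v, hv, rfl, rfl⟩
  | of_succ i _ ih =>
    obtain ⟨u, hu, hcu, hhu⟩ := ih
    obtain ⟨w, hw, hcw, hhw⟩ := hl.pred u hu (by omega)
    exact ⟨w, hw, hcw.trans hcu, by omega⟩

/-- Each nonempty class of a path labeling induces a path. -/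
lemma PathLabeling.exists_iso_pathGraph {P : Finset V} {c : V → ι} {h : V → ℕ}
    (hl : G.PathLabeling Set.univ c h) {a : ι} (hP : ∀ v, v ∈ P ↔ c v = a) (hne : P.Nonempty) :
    ∃ k : ℕ, 0 < k ∧ Nonempty (G.induce (P : Set V) ≃g pathGraph k) := by
  obtain ⟨m, hm, hmax⟩ := P.exists_max_image h hne
  have hP' : ∀ v : (P : Set V), c v = a := fun v ↦ (hP v).1 v.2
  let f : ↥(P : Set V) → Fin (h m + 1) := fun v ↦ ⟨h v, Nat.lt_succ_of_le (hmax v v.2)⟩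
  have hf : Function.Bijective f := by
    refine ⟨fun u v huv ↦ Subtype.ext ?_, fun i ↦ ?_⟩
    · exact hl.inj u trivial v trivial ((hP' u).trans (hP' v).symm) (congrArg Fin.val huv)
    · obtain ⟨u, -, hcu, hhu⟩ := hl.exists_height (Set.mem_univ m) (Nat.le_of_lt_succ i.2)
      exact ⟨⟨u, (hP u).2 (hcu.trans ((hP m).1 hm))⟩, Fin.ext hhu⟩
  refine ⟨h m + 1, Nat.succ_pos _, ⟨⟨Equiv.ofBijective f hf, fun {u v} ↦ ?_⟩⟩⟩
  rw [pathGraph_adj]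
  exact (hl.adj_iff u trivial v trivial ((hP' u).trans (hP' v).symm)).symm

/-- The heights along an induced path, as a function on all vertices. -/
lemma exists_height_of_iso_pathGraph {P : Finset V} {k : ℕ} (hk : 0 < k)
    (e : G.induce (P : Set V) ≃g pathGraph k) :
    ∃ f : V → ℕ, (∀ u ∈ P, ∀ v ∈ P, f u = f v → u = v) ∧
      (∀ v ∈ P, f v ≠ 0 → ∃ u ∈ P, f u + 1 = f v) ∧
      (∀ u ∈ P, ∀ v ∈ P, (G.Adj u v ↔ f u + 1 = f v ∨ f v + 1 = f u)) ∧
      ∃ v ∈ P, f v = 0 := by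
  classical
  let f : V → ℕ := fun v ↦ if hv : v ∈ P then (e ⟨v, hv⟩ : ℕ) else 0
  have hf : ∀ v (hv : v ∈ P), f v = (e ⟨v, hv⟩ : ℕ) := fun v hv ↦ by simp [f, hv]
  have hsurj : ∀ i < k, ∃ v ∈ P, f v = i := by
    intro i hi
    refine ⟨e.symm ⟨i, hi⟩, (e.symm ⟨i, hi⟩).2, ?_⟩
    rw [hf _ (e.symm ⟨i, hi⟩).2]
    simp
  refine ⟨f, fun u hu v hv huv ↦ ?_, fun v hv h0 ↦ ?_, fun u hu v hv ↦ ?_, hsurj 0 hk⟩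
  · rw [hf u hu, hf v hv] at huv
    exact congrArg Subtype.val (e.injective (Fin.ext huv))
  · have hlt : f v < k := by rw [hf v hv]; exact (e ⟨v, hv⟩).2
    obtain ⟨u, hu, hfu⟩ := hsurj (f v - 1) (by omega)
    exact ⟨u, hu, by omega⟩
  · rw [hf u hu, hf v hv, ← pathGraph_adj, e.map_adj_iff]
    rfl

/-- An acyclic graph has no nonempty finite set of vertices that injects into the edges it
spans. -/
lemma IsAcyclic.not_injective_edges [Finite V] [Nonempty V] (hG : G.IsAcyclic)
    (f : V → G.edgeSet) : ¬ Function.Injective f := by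
  intro hf
  obtain ⟨F, hGF, -, hF⟩ := connected_top.exists_isTree_le_of_le_of_isAcyclic le_top hG
  have hcard := (isTree_iff_connected_and_card.1 hF).2
  have hle : Nat.card V ≤ Nat.card F.edgeSet :=
    Nat.card_le_card_of_injective (Set.inclusion (edgeSet_mono hGF) ∘ f)
      ((Set.inclusion_injective _).comp hf)
  omega

/-- In a finite forest, the set of starting vertices of a path labeling is zero forcing. -/
lemma PathLabeling.isZeroForcingSet [Finite V] {c : V → ι} {h : V → ℕ}
    (hl : G.PathLabeling Set.univ c h) (hG : G.IsAcyclic) :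
    IsZeroForcingSet G {v | h v = 0} := by
  by_contra hnot
  simp only [IsZeroForcingSet, not_forall] at hnot
  obtain ⟨v₀, hv₀⟩ := hnot
  let black : V → Prop := ZFClosed G {v | h v = 0}
  let next : V → V → Prop := fun u w ↦ c u = c w ∧ h u + 1 = h w
  let A : Set V := {v | ¬ black v ∨ ∃ w, ¬ black w ∧ next v w}
  have hadj : ∀ {u w}, next u w → G.Adj u w := fun {u w} huw ↦
    (hl.adj_iff u trivial w trivial huw.1).2 (Or.inl huw.2)
  have hnext : ∀ {u w w'}, next u w → next u w' → w = w' := fun {u w w'} h₁ h₂ ↦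
    hl.inj w trivial w' trivial (h₁.1.symm.trans h₂.1) (h₁.2.symm.trans h₂.2)
  have hpartner : ∀ v : A, ∃ x : A, G.Adj v x ∧
      ((¬ black v ∧ next x v) ∨ (black v ∧ ¬ black x ∧ ¬ next v x)) := by
    rintro ⟨v, hv⟩
    by_cases hb : black v
    · obtain ⟨w, hw, hvw⟩ := hv.resolve_left (not_not.2 hb)
      have : ∃ x, G.Adj v x ∧ x ≠ w ∧ ¬ black x := by
        by_contra! hx
        exact hw (.force v w hb (hadj hvw) hx)
      obtain ⟨x, hvx, hxw, hx⟩ := this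
      exact ⟨⟨x, Or.inl hx⟩, hvx, Or.inr ⟨hb, hx, fun hn ↦ hxw (hnext hn hvw)⟩⟩
    · obtain ⟨u, -, huv⟩ := hl.pred v trivial fun h0 ↦ hb (.init v h0)
      exact ⟨⟨u, Or.inr ⟨v, hb, huv⟩⟩, (hadj huv).symm, Or.inl ⟨hb, huv⟩⟩
  choose p hp hp' using hpartner
  have : Nonempty A := ⟨⟨v₀, Or.inl hv₀⟩⟩
  refine (hG.induce A).not_injective_edges (fun v ↦ ⟨s(v, p v), hp v⟩) fun u v huv ↦ ?_
  rcases Sym2.eq_iff.1 (congrArg Subtype.val huv) with ⟨huv, -⟩ | ⟨huv, hvu⟩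
  · exact huv
  · have hu := hp' u
    have hv := hp' v
    rw [hvu] at hu
    rw [← huv] at hv
    grind

/-- A partial path labeling of `B` with starting vertices `S`, in which a vertex of `B` that is
not the last of its path has all its neighbors in `B`. -/
structure ForcingLabeling (G : SimpleGraph V) (S B : Set V) (c : V → V) (h : V → ℕ) : Prop
    extends G.PathLabeling B c h where
  subset : S ⊆ B
  label_mem : ∀ v ∈ B, c v ∈ S
  label_eq : ∀ v ∈ S, c v = v
  closed : ∀ u ∈ B, ∀ v ∈ B, c u = c v → h u < h v → ∀ x, G.Adj u x → x ∈ B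

lemma forcingLabeling_self (S : Set V) : G.ForcingLabeling S S id 0 where
  inj := by simp
  pred := by simp
  adj_iff := by
    rintro u - v - (rfl : u = v)
    simp
  subset := subset_rfl
  label_mem := by simp
  label_eq := by simp
  closed := by simp

open Classical in
/-- A force extends a forcing labeling. -/
lemma ForcingLabeling.insert {S B : Set V} {c : V → V} {h : V → ℕ}
    (hl : G.ForcingLabeling S B c h) {u w : V} (hu : u ∈ B) (hw : w ∉ B) (huw : G.Adj u w)
    (hB : ∀ x, G.Adj u x → x ≠ w → x ∈ B) :
    G.ForcingLabeling S (insert w B) (Function.update c w (c u))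
      (Function.update h w (h u + 1)) := by
  have hlast : ∀ v ∈ B, c v = c u → h v ≤ h u := fun v hv hc ↦
    not_lt.1 fun hlt ↦ hw (hl.closed u hu v hv hc.symm hlt w huw)
  have hne : ∀ v ∈ B, v ≠ w := fun v hv hvw ↦ hw (hvw ▸ hv)
  have hadj : ∀ v ∈ B, c v = c u → (G.Adj v w ↔ h v = h u) := fun v hv hc ↦ by
    refine ⟨fun hvw ↦ ?_, fun hh ↦ hl.inj v hv u hu hc hh ▸ huw⟩
    by_contra hh
    exact hw (hl.closed v hv u hu hc (lt_of_le_of_ne (hlast v hv hc) hh) w hvw)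
  have hinj := hl.inj
  have hpred := hl.pred
  have hiff := hl.adj_iff
  have hsub := hl.subset
  have hmem := hl.label_mem
  have heq := hl.label_eq
  have hcl := hl.closed
  constructor
  · constructor
    · simp only [Set.mem_insert_iff, Function.update_apply]
      grind
    · simp only [Set.mem_insert_iff, Function.update_apply]
      grind
    · rintro a (rfl | ha) b (rfl | hb) hab
      · simp
      · have := hadj b hb
        have := hlast b hb
        simp only [Function.update_apply, hne b hb, if_false, if_true] at hab ⊢
        rw [G.adj_comm]
        grind
      · have := hadj a ha
        have := hlast a ha
        simp only [Function.update_apply, hne a ha, if_false, if_true] at hab ⊢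
        grind
      · simp only [Function.update_apply, hne a ha, hne b hb, if_false] at hab ⊢
        exact hiff a ha b hb hab
  · exact hsub.trans (Set.subset_insert _ _)
  · simp only [Set.mem_insert_iff, Function.update_apply]
    grind
  · simp only [Function.update_apply]
    grind
  · simp only [Set.mem_insert_iff, Function.update_apply]
    grind

/-- The forcing chains of a zero forcing set form a path labeling of the whole graph. -/
lemma exists_forcingLabeling_univ [Finite V] {S : Set V} (hS : IsZeroForcingSet G S) :
    ∃ c h, G.ForcingLabeling S Set.univ c h := by
  obtain ⟨B, ⟨c, h, hl⟩, hmax⟩ := (Set.toFinite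
    {B : Set V | ∃ c h, G.ForcingLabeling S B c h}).exists_maximal
      ⟨S, id, 0, forcingLabeling_self S⟩
  suffices hB : B = Set.univ from ⟨c, h, hB ▸ hl⟩
  refine Set.eq_univ_of_forall fun v ↦ ?_
  induction hS v with
  | init v hv => exact hl.subset hv
  | force u w _ huw _ hu ih =>
    by_contra hw
    exact hw (hmax ⟨_, _, hl.insert hu hw huw ih⟩ (Set.subset_insert w B) (Set.mem_insert w B))

variable [Fintype V]

lemma exists_isPathCover_of_isZeroForcingSet {S : Finset V} (hS : IsZeroForcingSet G ↑S) :
    ∃ PC : Finset (Finset V), PC.card = S.card ∧ IsPathCover G PC := by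
  classical
  obtain ⟨c, h, hl⟩ := exists_forcingLabeling_univ hS
  let P : V → Finset V := fun s ↦ {v | c v = s}
  have hP : ∀ v s, v ∈ P s ↔ c v = s := by simp [P]
  have hself : ∀ s ∈ S, s ∈ P s := fun s hs ↦ (hP s s).2 (hl.label_eq s hs)
  refine ⟨S.image P, Finset.card_image_of_injOn fun s hs t _ hst ↦ ?_, ?_, ?_, fun v ↦ ?_⟩
  · have := hself s hs
    rw [hst, hP, hl.label_eq s hs] at this
    exact this
  · rw [Finset.forall_mem_image]
    exact fun s hs ↦ hl.exists_iso_pathGraph (fun v ↦ hP v s) ⟨s, hself s hs⟩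
  · simp only [Finset.forall_mem_image]
    refine fun s _ t _ hst ↦ Finset.disjoint_left.2 fun v hvs hvt ↦ hst ?_
    rw [← (hP v s).1 hvs, ← (hP v t).1 hvt]
  · exact ⟨P (c v), Finset.mem_image_of_mem P (hl.label_mem v trivial), (hP v _).2 rfl⟩

lemma IsAcyclic.exists_isZeroForcingSet_of_isPathCover (hG : G.IsAcyclic)
    {PC : Finset (Finset V)} (hPC : IsPathCover G PC) :
    ∃ S : Finset V, S.card = PC.card ∧ IsZeroForcingSet G ↑S := by
  classical
  obtain ⟨hpath, hdisj, hcover⟩ := hPC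
  choose c hcPC hc using hcover
  have hc_eq : ∀ {v P}, P ∈ PC → v ∈ P → c v = P := fun {v P} hP hv ↦ by
    by_contra hne
    exact Finset.disjoint_left.1 (hdisj _ (hcPC v) _ hP hne) (hc v) hv
  have hheight : ∀ P : Finset V, ∃ f : V → ℕ, P ∈ PC →
      (∀ u ∈ P, ∀ v ∈ P, f u = f v → u = v) ∧
      (∀ v ∈ P, f v ≠ 0 → ∃ u ∈ P, f u + 1 = f v) ∧
      (∀ u ∈ P, ∀ v ∈ P, (G.Adj u v ↔ f u + 1 = f v ∨ f v + 1 = f u)) ∧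
      ∃ v ∈ P, f v = 0 := fun P ↦ by
    by_cases hP : P ∈ PC
    · obtain ⟨k, hk, ⟨e⟩⟩ := hpath P hP
      obtain ⟨f, hf⟩ := exists_height_of_iso_pathGraph hk e
      exact ⟨f, fun _ ↦ hf⟩
    · exact ⟨0, fun h ↦ absurd h hP⟩
  choose f hf using hheight
  have hl : G.PathLabeling Set.univ c (fun v ↦ f (c v) v) := by
    refine ⟨fun u _ v _ huv hh ↦ ?_, fun v _ h0 ↦ ?_, fun u _ v _ huv ↦ ?_⟩
    · exact (hf _ (hcPC v)).1 u (huv ▸ hc u) v (hc v) (by simpa only [huv] using hh)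
    · obtain ⟨u, hu, hhu⟩ := (hf _ (hcPC v)).2.1 v (hc v) h0
      have huv := hc_eq (hcPC v) hu
      exact ⟨u, trivial, huv, by simpa only [huv] using hhu⟩
    · simpa only [huv] using (hf _ (hcPC v)).2.2.1 u (huv ▸ hc u) v (hc v)
  refine ⟨Finset.univ.filter fun v ↦ f (c v) v = 0,
    Finset.card_bij (fun v _ ↦ c v) (fun v _ ↦ hcPC v) ?_ ?_, ?_⟩
  · intro u hu v hv huv
    simp only [Finset.mem_filter_univ] at hu hv
    exact hl.inj u trivial v trivial huv (hu.trans hv.symm)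
  · intro P hP
    obtain ⟨v, hv, hv0⟩ := (hf P hP).2.2.2
    have hcv := hc_eq hP hv
    exact ⟨v, by simpa only [Finset.mem_filter_univ, hcv] using hv0, hcv⟩
  · simpa using hl.isZeroForcingSet hG

end SimpleGraph

/-- For every tree `T`, the zero forcing number equals the path cover number:
`Z(T) = P(T)`. -/
theorem zeroForcingNumber_tree_eq_pathCoverNumber (V : Type*) [Fintype V] (T : SimpleGraph V)
    (hconn : T.Connected) (hacyc : T.IsAcyclic) :
    zeroForcingNumber T = pathCoverNumber T := by
  unfold zeroForcingNumber pathCoverNumber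
  congr 1
  ext k
  constructor
  · rintro ⟨S, rfl, hS⟩
    exact SimpleGraph.exists_isPathCover_of_isZeroForcingSet hS
  · rintro ⟨PC, rfl, hPC⟩
    exact hacyc.exists_isZeroForcingSet_of_isPathCover hPC
end

section
/- For every simple graph G on n vertices, the zero forcing number satisfies Z(G) ≥ δ(G), the minimum degree of G. -/
/-- A set with fewer vertices than the minimum degree allows no force: its closure under the color
change rule is the set itself. -/
theorem ZFClosed.mem_of_card_lt_minDegree {V : Type*} [Fintype V] {G : SimpleGraph V}
    [DecidableRel G.Adj] {S : Finset V} (hS : S.card < G.minDegree) {v : V}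
    (hv : ZFClosed G ↑S v) : v ∈ S := by
  classical
  induction hv with
  | init v hv => exact hv
  | force u w _ hadj _ hu h =>
    have hsub : insert u ((G.neighborFinset u).erase w) ⊆ S := by
      intro x hx
      rcases Finset.mem_insert.1 hx with rfl | hx
      · exact hu
      · rw [Finset.mem_erase, G.mem_neighborFinset] at hx
        exact h x hx.2 hx.1
    have hcard := Finset.card_le_card hsub
    rw [Finset.card_insert_of_notMem (by simp),
      Finset.card_erase_add_one ((G.mem_neighborFinset u w).2 hadj),
      G.card_neighborFinset_eq_degree] at hcard
    have := G.minDegree_le_degree u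
    omega

theorem IsZeroForcingSet.minDegree_le_card {V : Type*} [Fintype V] {G : SimpleGraph V}
    [DecidableRel G.Adj] {S : Finset V} (hS : IsZeroForcingSet G ↑S) :
    G.minDegree ≤ S.card := by
  by_contra! hlt
  have huniv : S = Finset.univ :=
    Finset.eq_univ_of_forall fun v => (hS v).mem_of_card_lt_minDegree hlt
  obtain hV | hV := isEmpty_or_nonempty V
  · simp at hlt
  · have := G.minDegree_lt_card
    rw [huniv, Finset.card_univ] at hlt
    omega

/-- The zero forcing number of a graph is at least its minimum degree:
`Z(G) ≥ δ(G)`. -/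
theorem minDegree_le_zeroForcingNumber (V : Type*) [Fintype V] (G : SimpleGraph V)
    [DecidableRel G.Adj] :
    G.minDegree ≤ zeroForcingNumber G := by
  refine le_csInf ⟨_, Finset.univ, rfl, fun v => .init v (by simp)⟩ ?_
  rintro _ ⟨S, rfl, hS⟩
  exact hS.minDegree_le_card
end

section
/- For every simple graph G on n vertices, if S is a zero forcing set of G then every real symmetric matrix A whose off-diagonal zero-nonzero pattern is given by G and whose null vector x satisfies x_v = 0 for all v ∈ S must satisfy x = 0; consequently the nullity of any such matrix is at most |S|. -/
open Matrix

/-- A null vector of a matrix described by `G` that vanishes on `S` vanishes on every vertex that is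
eventually colored black starting from `S`. -/
theorem DescribesGraph.eq_zero_of_zfClosed {V : Type*} [Fintype V] {G : SimpleGraph V}
    {A : Matrix V V ℝ} (hA : DescribesGraph G A) {S : Set V} {x : V → ℝ} (hx : A *ᵥ x = 0)
    (hxS : ∀ v ∈ S, x v = 0) {v : V} (hv : ZFClosed G S v) : x v = 0 := by
  induction hv with
  | init v hv => exact hxS v hv
  | force u w _ hadj _ ihu ih =>
    have hsum : ∑ y, A u y * x y = A u w * x w := by
      refine Fintype.sum_eq_single w fun y hyw => ?_
      rcases eq_or_ne u y with rfl | huy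
      · rw [ihu, mul_zero]
      · by_cases hy : G.Adj u y
        · rw [ih y hy hyw, mul_zero]
        · rw [not_ne_iff.mp (mt (hA.2 u y huy).mp hy), zero_mul]
    have hzero : A u w * x w = 0 := hsum.symm.trans (congrFun hx u)
    exact (mul_eq_zero.mp hzero).resolve_left ((hA.2 u w hadj.ne).mpr hadj)

/-- If `S` is a zero forcing set of `G` then every matrix `A` described by `G` with a null
vector vanishing on `S` has that null vector equal to `0`; consequently the nullity of `A` is at
most `|S|`. -/
theorem zeroForcing_null_vector (V : Type*) [Fintype V] (G : SimpleGraph V) (S : Finset V)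
    (hS : IsZeroForcingSet G (S : Set V)) (A : Matrix V V ℝ) (hA : DescribesGraph G A) :
    (∀ x : V → ℝ, A.mulVec x = 0 → (∀ v ∈ S, x v = 0) → x = 0) ∧
      Module.finrank ℝ (LinearMap.ker A.mulVecLin) ≤ S.card := by
  have hnull : ∀ x : V → ℝ, A *ᵥ x = 0 → (∀ v ∈ S, x v = 0) → x = 0 := fun x hx hxS =>
    funext fun v => hA.eq_zero_of_zfClosed hx hxS (hS v)
  refine ⟨hnull, ?_⟩
  let restrict : LinearMap.ker A.mulVecLin →ₗ[ℝ] S → ℝ :=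
    LinearMap.funLeft ℝ ℝ Subtype.val ∘ₗ Submodule.subtype _
  have hinj : Function.Injective restrict := by
    refine (injective_iff_map_eq_zero restrict).mpr fun x hx => Subtype.ext ?_
    exact hnull x x.2 fun v hv => congrFun hx ⟨v, hv⟩
  simpa using LinearMap.finrank_le_finrank_of_injective hinj
end
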